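/- Let φ(x) = (1/√(2π)) e^{−x²/2}, Φ(x) = ∫_{−∞}^x φ(y) dy, H_k the k-th probabilist's Hermite polynomial, and for κ > 1 set r_n = n^{1/κ}. Fix m ∈ ℕ, K > 0, and an integer J with J > 2m + (Kκ − 1)/2. For n ≥ 2 and y, z ∈ ℝ define ε_n(y,z) = [Φ((z + y)/√(r_n − √r_n)) − Φ((z − y)/√(r_n − √r_n))] − 2 φ(z/√r_n) · Σ_{k=0}^J (1/(2k+1)!) · r_n^{−(2k+1)/4} · H_{2k}(z/√r_n) · H_{2k+1}(y/r_n^{1/4}). Then r_n^{(2m+1)/2} · sup{ |ε_n(y,z)| : z ∈ ℝ, |y| ≤ √(K √r_n · log n) } → 0 as n → ∞. -/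

import Mathlib

open Real Finset Filter

/-- The standard Gaussian density `φ(x) = (1/√(2π)) e^{−x²/2}`. -/
noncomputable def stdGaussianPDF (x : ℝ) : ℝ := (1 / Real.sqrt (2 * π)) * Real.exp (-x ^ 2 / 2)

/-- The standard Gaussian cumulative distribution function `Φ(x) = ∫_{−∞}^x φ(y) dy`. -/
noncomputable def stdGaussianCDF (x : ℝ) : ℝ := ∫ y in Set.Iic x, stdGaussianPDF y

/-- The `k`-th probabilist's Hermite polynomial, given by its explicit expansion:
`H_k(x) = Σ_{j=0}^{⌊k/2⌋} k! (−1)^j / (2^j j! (k−2j)!) x^{k−2j}` (with `H₀ = 1`). -/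
noncomputable def hermiteP (k : ℕ) (x : ℝ) : ℝ :=
  ∑ j ∈ Finset.range (k / 2 + 1),
    ((k.factorial : ℝ) * (-1 : ℝ) ^ j /
        (2 ^ j * (j.factorial : ℝ) * ((k - 2 * j).factorial : ℝ))) * x ^ (k - 2 * j)

/-- The sequence `r_n = n^{1/κ}`. -/
noncomputable def rseq (κ : ℝ) (n : ℕ) : ℝ := (n : ℝ) ^ ((1 : ℝ) / κ)

/-- The error `ε_n(y,z)` in the truncated (at order `J`) expansion of
`Φ((z+y)/√(r_n−√r_n)) − Φ((z−y)/√(r_n−√r_n))` in Hermite polynomials. -/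
noncomputable def cdfExpErr (κ : ℝ) (J : ℕ) (n : ℕ) (y z : ℝ) : ℝ :=
  (stdGaussianCDF ((z + y) / Real.sqrt (rseq κ n - Real.sqrt (rseq κ n))) -
      stdGaussianCDF ((z - y) / Real.sqrt (rseq κ n - Real.sqrt (rseq κ n)))) -
    2 * stdGaussianPDF (z / Real.sqrt (rseq κ n)) *
      ∑ k ∈ Finset.range (J + 1),
        (1 / ((2 * k + 1).factorial : ℝ)) * (rseq κ n) ^ (-(2 * (k : ℝ) + 1) / 4) *
          hermiteP (2 * k) (z / Real.sqrt (rseq κ n)) *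
          hermiteP (2 * k + 1) (y / (rseq κ n) ^ ((1 : ℝ) / 4))

/-- The `j`-th summand of `hermiteP k x`, extended by zero. -/
noncomputable def hermiteTerm (x : ℝ) (k j : ℕ) : ℝ :=
  if 2 * j ≤ k then
    ((k.factorial : ℝ) * (-1 : ℝ) ^ j /
        (2 ^ j * (j.factorial : ℝ) * ((k - 2 * j).factorial : ℝ))) * x ^ (k - 2 * j)
  else 0

theorem hermiteP_eq_sum_hermiteTerm (x : ℝ) {k N : ℕ} (h : k / 2 + 1 ≤ N) :
    hermiteP k x = ∑ j ∈ Finset.range N, hermiteTerm x k j := by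
  have hsub : Finset.range (k / 2 + 1) ⊆ Finset.range N := by
    intro i hi
    simp only [Finset.mem_range] at hi ⊢
    omega
  rw [← Finset.sum_subset hsub]
  · refine Finset.sum_congr rfl fun j hj => ?_
    rw [Finset.mem_range] at hj
    rw [hermiteTerm, if_pos (by omega)]
  · intro j _ hj
    rw [Finset.mem_range] at hj
    rw [hermiteTerm, if_neg (by omega)]

theorem hermiteTerm_zero_right (x : ℝ) (k : ℕ) : hermiteTerm x k 0 = x ^ k := by
  have : (k.factorial : ℝ) ≠ 0 := by positivity
  simp [hermiteTerm, this]

theorem hermiteTerm_succ_succ (x : ℝ) (k j : ℕ) :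
    hermiteTerm x (k + 2) (j + 1) =
      x * hermiteTerm x (k + 1) (j + 1) - (k + 1) * hermiteTerm x k j := by
  unfold hermiteTerm
  by_cases h : 2 * j ≤ k
  · obtain ⟨l, rfl⟩ := Nat.exists_eq_add_of_le h
    have h1 : 2 * j + l + 2 - 2 * (j + 1) = l := by omega
    have h2 : 2 * j + l - 2 * j = l := by omega
    rw [if_pos (by omega), if_pos h, h1, h2]
    rcases l with _ | l
    · rw [if_neg (by omega)]
      simp only [Nat.factorial_succ, pow_succ, Nat.add_zero]
      push_cast
      field_simp
      ring
    · have h3 : 2 * j + (l + 1) + 1 - 2 * (j + 1) = l := by omega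
      rw [if_pos (by omega), h3]
      have e1 : 2 * j + (l + 1) + 2 = (2 * j + l + 2) + 1 := by ring
      have e2 : 2 * j + (l + 1) + 1 = (2 * j + l + 1) + 1 := by ring
      have e3 : 2 * j + (l + 1) = (2 * j + l) + 1 := by ring
      rw [e1, e2, e3]
      simp only [Nat.factorial_succ, pow_succ]
      push_cast
      field_simp
      ring
  · rw [if_neg h, if_neg (by omega), if_neg (by omega)]
    ring

theorem hermiteP_zero (x : ℝ) : hermiteP 0 x = 1 := by simp [hermiteP]

theorem hermiteP_one (x : ℝ) : hermiteP 1 x = x := by simp [hermiteP]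

theorem hermiteP_add_two (k : ℕ) (x : ℝ) :
    hermiteP (k + 2) x = x * hermiteP (k + 1) x - (k + 1) * hermiteP k x := by
  rw [hermiteP_eq_sum_hermiteTerm x (show (k + 2) / 2 + 1 ≤ (k + 2) + 1 by omega),
    hermiteP_eq_sum_hermiteTerm x (show (k + 1) / 2 + 1 ≤ (k + 2) + 1 by omega),
    hermiteP_eq_sum_hermiteTerm x (show k / 2 + 1 ≤ k + 2 by omega),
    Finset.sum_range_succ', Finset.sum_range_succ' _ (k + 2)]
  simp only [hermiteTerm_succ_succ, hermiteTerm_zero_right, Finset.sum_sub_distrib,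
    ← Finset.mul_sum]
  ring

theorem hermiteP_add_one (k : ℕ) (x : ℝ) :
    hermiteP (k + 1) x = x * hermiteP k x - k * hermiteP (k - 1) x := by
  rcases k with _ | k
  · simp [hermiteP_zero, hermiteP_one]
  · rw [hermiteP_add_two]
    simp

theorem factorial_two_mul_le (j : ℕ) : (2 * j).factorial ≤ (2 ^ j * j.factorial) ^ 2 := by
  induction j with
  | zero => simp
  | succ j ih =>
    have h : (2 * (j + 1)).factorial = (2 * j + 2) * ((2 * j + 1) * (2 * j).factorial) := by
      rw [show 2 * (j + 1) = 2 * j + 1 + 1 by ring, Nat.factorial_succ, Nat.factorial_succ]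
    calc (2 * (j + 1)).factorial = (2 * j + 2) * ((2 * j + 1) * (2 * j).factorial) := h
      _ ≤ (2 * j + 2) * ((2 * j + 2) * (2 ^ j * j.factorial) ^ 2) := by gcongr; omega
      _ = (2 ^ (j + 1) * (j + 1).factorial) ^ 2 := by
        rw [Nat.factorial_succ]; ring

theorem abs_pow_le_sqrt_factorial_mul_exp (x : ℝ) (l : ℕ) :
    |x| ^ l ≤ √(l.factorial * 2 ^ l) * Real.exp (x ^ 2 / 4) := by
  have h := Real.pow_div_factorial_le_exp (x := x ^ 2 / 2) (by positivity) l
  refine abs_le_of_sq_le_sq' ?_ (by positivity) |>.2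
  rw [mul_pow, Real.sq_sqrt (by positivity), ← Real.exp_nat_mul]
  rw [div_le_iff₀ (by positivity), div_pow, div_le_iff₀ (by positivity)] at h
  calc (|x| ^ l) ^ 2 = (x ^ 2) ^ l := by rw [← pow_mul, mul_comm, pow_mul, sq_abs]
    _ ≤ _ := h
    _ = _ := by
      rw [show ((2 : ℕ) : ℝ) * (x ^ 2 / 4) = x ^ 2 / 2 by push_cast; ring]
      ring

theorem factorial_div_mul_sqrt_le {k j : ℕ} (h : 2 * j ≤ k) :
    (k.factorial : ℝ) / (2 ^ j * j.factorial * (k - 2 * j).factorial) *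
      √((k - 2 * j).factorial * 2 ^ (k - 2 * j)) ≤ √(k.factorial) * 2 ^ k := by
  refine abs_le_of_sq_le_sq' ?_ (by positivity) |>.2
  rw [mul_pow, mul_pow, Real.sq_sqrt (by positivity), Real.sq_sqrt (by positivity)]
  have h1 : ((2 * j).factorial : ℝ) ≤ (2 ^ j * j.factorial) ^ 2 := by
    exact_mod_cast factorial_two_mul_le j
  have h2 : (k.factorial : ℝ) ≤ 2 ^ k * ((2 * j).factorial * (k - 2 * j).factorial) := by
    have e := Nat.choose_mul_factorial_mul_factorial h
    have : k.choose (2 * j) ≤ 2 ^ k := Nat.choose_le_two_pow _ _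
    rw [← e]
    push_cast
    rw [mul_assoc]
    gcongr
    exact_mod_cast this
  have h3 : (2 : ℝ) ^ (k - 2 * j) ≤ 2 ^ k := by gcongr <;> simp
  rw [div_pow, div_mul_eq_mul_div, div_le_iff₀ (by positivity)]
  set f : ℝ := ((k - 2 * j).factorial : ℝ) with hf
  have hf0 : 0 < f := by positivity
  calc (k.factorial : ℝ) ^ 2 * (f * 2 ^ (k - 2 * j))
      = k.factorial * k.factorial * (f * 2 ^ (k - 2 * j)) := by ring
    _ ≤ k.factorial * (2 ^ k * ((2 ^ j * j.factorial) ^ 2 * f)) * (f * 2 ^ k) := by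
      gcongr
      exact h2.trans (by gcongr)
    _ = _ := by ring

theorem abs_hermiteP_le (k : ℕ) (x : ℝ) :
    |hermiteP k x| ≤ 4 ^ k * √(k.factorial) * Real.exp (x ^ 2 / 4) := by
  have hterm : ∀ j ∈ Finset.range (k / 2 + 1),
      |((k.factorial : ℝ) * (-1 : ℝ) ^ j /
        (2 ^ j * (j.factorial : ℝ) * ((k - 2 * j).factorial : ℝ))) * x ^ (k - 2 * j)| ≤
        √(k.factorial) * 2 ^ k * Real.exp (x ^ 2 / 4) := by
    intro j hj
    rw [Finset.mem_range] at hj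
    have hjk : 2 * j ≤ k := by omega
    rw [abs_mul, abs_div, abs_mul, abs_pow, abs_pow, abs_neg, abs_one, one_pow, mul_one,
      Nat.abs_cast, abs_of_pos (show (0 : ℝ) < 2 ^ j * j.factorial * (k - 2 * j).factorial by
        positivity)]
    calc _ ≤ (k.factorial : ℝ) / (2 ^ j * j.factorial * (k - 2 * j).factorial) *
          (√((k - 2 * j).factorial * 2 ^ (k - 2 * j)) * Real.exp (x ^ 2 / 4)) := by
          gcongr
          exact abs_pow_le_sqrt_factorial_mul_exp x _
      _ ≤ _ := by
          rw [← mul_assoc]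
          exact mul_le_mul_of_nonneg_right (factorial_div_mul_sqrt_le hjk) (Real.exp_nonneg _)
  have hcard : ((k / 2 + 1 : ℕ) : ℝ) ≤ 2 ^ k := by
    have : k / 2 + 1 ≤ 2 ^ k := by
      have := Nat.lt_two_pow_self (n := k)
      omega
    exact_mod_cast this
  calc |hermiteP k x| ≤ _ := Finset.abs_sum_le_sum_abs _ _
    _ ≤ _ := Finset.sum_le_sum hterm
    _ = ((k / 2 + 1 : ℕ) : ℝ) * (√(k.factorial) * 2 ^ k * Real.exp (x ^ 2 / 4)) := by
      rw [Finset.sum_const, Finset.card_range, nsmul_eq_mul]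
    _ ≤ 2 ^ k * (√(k.factorial) * 2 ^ k * Real.exp (x ^ 2 / 4)) := by gcongr
    _ = _ := by
      rw [show (4 : ℝ) = 2 * 2 by norm_num, mul_pow]
      ring

theorem exists_abs_hermiteP_add_le (p : ℕ) (x : ℝ) :
    ∃ D : ℝ, 0 ≤ D ∧ ∀ k, |hermiteP (k + p) x| ≤ D * (8 ^ k * √(k.factorial)) := by
  refine ⟨8 ^ p * √(p.factorial) * Real.exp (x ^ 2 / 4), by positivity, fun k => ?_⟩
  have hfac : √((k + p).factorial) ≤ 2 ^ (k + p) * (√(k.factorial) * √(p.factorial)) := by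
    refine abs_le_of_sq_le_sq' ?_ (by positivity) |>.2
    rw [mul_pow, mul_pow, Real.sq_sqrt (by positivity), Real.sq_sqrt (by positivity),
      Real.sq_sqrt (by positivity), ← Nat.add_choose_mul_factorial_mul_factorial k p]
    push_cast
    rw [mul_assoc]
    gcongr
    calc ((k + p).choose p : ℝ) ≤ 2 ^ (k + p) := by exact_mod_cast Nat.choose_le_two_pow _ _
      _ ≤ (2 ^ (k + p)) ^ 2 := le_self_pow₀ (one_le_pow₀ (by norm_num)) (by norm_num)
  calc |hermiteP (k + p) x| ≤ 4 ^ (k + p) * √((k + p).factorial) * Real.exp (x ^ 2 / 4) :=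
        abs_hermiteP_le _ _
    _ ≤ 4 ^ (k + p) * (2 ^ (k + p) * (√(k.factorial) * √(p.factorial))) *
        Real.exp (x ^ 2 / 4) := by gcongr
    _ = (4 * 2) ^ (k + p) * (√(k.factorial) * √(p.factorial)) * Real.exp (x ^ 2 / 4) := by
      rw [mul_pow]; ring
    _ = _ := by norm_num [pow_add]; ring

/-- Coefficients of the shifted Mehler series. -/
noncomputable def mehlerCoeff (a b : ℝ) (p q k : ℕ) : ℝ :=
  hermiteP (k + p) a * hermiteP (k + q) b / k.factorial

/-- The shifted Mehler series `∑ H_{k+p}(a) H_{k+q}(b) x^k / k!`. -/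
noncomputable def mehlerSeries (a b : ℝ) (p q : ℕ) (x : ℝ) : ℝ :=
  ∑' k, mehlerCoeff a b p q k * x ^ k

theorem exists_abs_mehlerCoeff_le (a b : ℝ) (p q : ℕ) :
    ∃ E : ℝ, ∀ k, |mehlerCoeff a b p q k| ≤ E * 64 ^ k := by
  obtain ⟨D, hD, h1⟩ := exists_abs_hermiteP_add_le p a
  obtain ⟨D', hD', h2⟩ := exists_abs_hermiteP_add_le q b
  refine ⟨D * D', fun k => ?_⟩
  rw [mehlerCoeff, abs_div, abs_mul, Nat.abs_cast, div_le_iff₀ (by positivity)]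
  calc _ ≤ (D * (8 ^ k * √(k.factorial))) * (D' * (8 ^ k * √(k.factorial))) :=
        mul_le_mul (h1 k) (h2 k) (abs_nonneg _) (by positivity)
    _ = D * D' * (8 * 8) ^ k * (√(k.factorial) * √(k.factorial)) := by rw [mul_pow]; ring
    _ = _ := by rw [Real.mul_self_sqrt (by positivity)]; norm_num

theorem summable_of_abs_le_geometric {c : ℕ → ℝ} {E A x : ℝ} (hA : 0 < A)
    (hc : ∀ k, |c k| ≤ E * A ^ k) (hx : |x| < 1 / A) : Summable fun k => c k * x ^ k := by
  rw [lt_div_iff₀ hA] at hx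
  refine Summable.of_norm_bounded (g := fun k => E * (|x| * A) ^ k)
    ((summable_geometric_of_lt_one (by positivity) hx).mul_left E) fun k => ?_
  rw [norm_mul, norm_pow, Real.norm_eq_abs, Real.norm_eq_abs, mul_pow]
  calc |c k| * |x| ^ k ≤ (E * A ^ k) * |x| ^ k := by gcongr; exact hc k
    _ = _ := by ring

theorem norm_mul_deriv_pow_le {c : ℕ → ℝ} {E A y : ℝ} (hA : 0 < A)
    (hc : ∀ k, |c k| ≤ E * A ^ k) (hy : |y| ≤ 1 / (2 * A)) (n : ℕ) :
    ‖c n * (n * y ^ (n - 1))‖ ≤ 2 * E * A * ((n : ℝ) ^ 1 * (1 / 2 : ℝ) ^ n) := by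
  rcases n with _ | n
  · simp
  · have hE : 0 ≤ E * A ^ (n + 1) := (abs_nonneg _).trans (hc _)
    rw [Real.norm_eq_abs, abs_mul, abs_mul, abs_pow, Nat.abs_cast, Nat.add_sub_cancel, pow_one]
    calc |c (n + 1)| * (((n + 1 : ℕ) : ℝ) * |y| ^ n)
        ≤ (E * A ^ (n + 1)) * (((n + 1 : ℕ) : ℝ) * (1 / (2 * A)) ^ n) := by
          gcongr
          exact hc _
      _ = _ := by
          rw [div_pow, div_pow, mul_pow]
          field_simp
          ring

theorem hasDerivAt_tsum_mul_pow {c : ℕ → ℝ} {E A x : ℝ} (hA : 0 < A)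
    (hc : ∀ k, |c k| ≤ E * A ^ k) (hx : |x| < 1 / (2 * A)) :
    HasDerivAt (fun y => ∑' k, c k * y ^ k) (∑' k, (c (k + 1) * (k + 1)) * x ^ k) x := by
  have hu : Summable fun n : ℕ => 2 * E * A * ((n : ℝ) ^ 1 * (1 / 2 : ℝ) ^ n) :=
    (summable_pow_mul_geometric_of_norm_lt_one (R := ℝ) (r := (1 / 2 : ℝ)) 1
      (by norm_num)).mul_left _
  have hzero : |(0 : ℝ)| < 1 / A := by simpa using hA
  have hd := hasDerivAt_tsum_of_isPreconnected (y₀ := 0) (y := x) hu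
    (t := Set.Ioo (-(1 / (2 * A))) (1 / (2 * A))) isOpen_Ioo
    isPreconnected_Ioo (g := fun k y => c k * y ^ k) (g' := fun k y => c k * (k * y ^ (k - 1)))
    (fun n y _ => (hasDerivAt_pow n y).const_mul (c n))
    (fun n y hy => norm_mul_deriv_pow_le hA hc (abs_lt.2 hy).le n)
    (by simpa using hA) (summable_of_abs_le_geometric hA hc hzero) (abs_lt.1 hx)
  refine hd.congr_deriv ?_
  rw [(Summable.of_norm_bounded hu fun n => norm_mul_deriv_pow_le hA hc hx.le n).tsum_eq_zero_add]
  simp [mul_assoc]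

theorem summable_mehlerSeries (a b : ℝ) (p q : ℕ) {x : ℝ} (hx : |x| < 1 / 128) :
    Summable fun k => mehlerCoeff a b p q k * x ^ k := by
  obtain ⟨E, hE⟩ := exists_abs_mehlerCoeff_le a b p q
  exact summable_of_abs_le_geometric (by norm_num) hE (hx.trans (by norm_num))

theorem hasSum_mehlerSeries (a b : ℝ) (p q : ℕ) {x : ℝ} (hx : |x| < 1 / 128) :
    HasSum (fun k => mehlerCoeff a b p q k * x ^ k) (mehlerSeries a b p q x) :=
  (summable_mehlerSeries a b p q hx).hasSum

theorem mehlerSeries_comm (a b : ℝ) (p q : ℕ) (x : ℝ) :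
    mehlerSeries a b p q x = mehlerSeries b a q p x := by
  simp only [mehlerSeries, mehlerCoeff, mul_comm (hermiteP _ a)]

theorem hasSum_mul_mehlerCoeff_pred (a b : ℝ) (p q : ℕ) {x : ℝ} (hx : |x| < 1 / 128) :
    HasSum (fun k : ℕ => k * (hermiteP (k - 1 + p) a * hermiteP (k - 1 + q) b / k.factorial) * x ^ k)
      (x * mehlerSeries a b p q x) := by
  rw [← hasSum_nat_add_iff' 1]
  simp only [Finset.sum_range_one, Nat.cast_zero, zero_mul, sub_zero]
  refine HasSum.congr_fun ((hasSum_mehlerSeries a b p q hx).mul_left x) fun k => ?_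
  rw [mehlerCoeff, Nat.factorial_succ, Nat.add_sub_cancel, pow_succ]
  push_cast
  field_simp

theorem mehlerSeries_one_right (a b : ℝ) (p : ℕ) {x : ℝ} (hx : |x| < 1 / 128) :
    mehlerSeries a b p 1 x = b * mehlerSeries a b p 0 x - x * mehlerSeries a b (p + 1) 0 x := by
  refine (hasSum_mehlerSeries a b p 1 hx).unique ?_
  refine HasSum.congr_fun (((hasSum_mehlerSeries a b p 0 hx).mul_left b).sub
    (hasSum_mul_mehlerCoeff_pred a b (p + 1) 0 hx)) fun k => ?_
  simp only [mehlerCoeff, hermiteP_add_one, add_zero]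
  rcases k with _ | k
  · simp; ring
  · rw [show k + 1 - 1 + (p + 1) = k + 1 + p by omega]
    ring

theorem mehlerSeries_one_left (a b : ℝ) (q : ℕ) {x : ℝ} (hx : |x| < 1 / 128) :
    mehlerSeries a b 1 q x = a * mehlerSeries a b 0 q x - x * mehlerSeries a b 0 (q + 1) x := by
  rw [mehlerSeries_comm, mehlerSeries_one_right b a q hx, mehlerSeries_comm b a,
    mehlerSeries_comm b a]

theorem mehlerSeries_two_zero (a b : ℝ) {x : ℝ} (hx : |x| < 1 / 128) :
    mehlerSeries a b 2 0 x = a * mehlerSeries a b 1 0 x -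
      (x * mehlerSeries a b 1 1 x + mehlerSeries a b 0 0 x) := by
  refine (hasSum_mehlerSeries a b 2 0 hx).unique ?_
  refine HasSum.congr_fun (((hasSum_mehlerSeries a b 1 0 hx).mul_left a).sub
    ((hasSum_mul_mehlerCoeff_pred a b 1 1 hx).add (hasSum_mehlerSeries a b 0 0 hx))) fun k => ?_
  simp only [mehlerCoeff, hermiteP_add_two, add_zero]
  rcases k with _ | k
  · simp; ring
  · rw [Nat.add_sub_cancel]
    push_cast
    ring

theorem one_sub_sq_pos {x : ℝ} (hx : |x| < 1 / 128) : 0 < 1 - x ^ 2 := by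
  rw [abs_lt] at hx
  nlinarith

theorem mehlerSeries_zero_one (a b : ℝ) {x : ℝ} (hx : |x| < 1 / 128) :
    mehlerSeries a b 0 1 x = (b - x * a) / (1 - x ^ 2) * mehlerSeries a b 0 0 x := by
  have h := one_sub_sq_pos hx
  have h1 := mehlerSeries_one_right a b 0 hx
  have h2 := mehlerSeries_one_left a b 0 hx
  simp only [zero_add] at h1 h2
  field_simp
  rw [h2] at h1
  linarith

theorem mehlerSeries_one_one (a b : ℝ) {x : ℝ} (hx : |x| < 1 / 128) :
    mehlerSeries a b 1 1 x = ((b - x * a) * (a - x * b) / (1 - x ^ 2) ^ 2 + x / (1 - x ^ 2)) *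
      mehlerSeries a b 0 0 x := by
  have h := one_sub_sq_pos hx
  have h1 := mehlerSeries_one_right a b 1 hx
  have h2 := mehlerSeries_two_zero a b hx
  have h3 := mehlerSeries_zero_one b a hx
  rw [mehlerSeries_comm b a, mehlerSeries_comm b a] at h3
  rw [show 1 + 1 = 2 from rfl, h2] at h1
  have h4 : mehlerSeries a b 1 1 x * (1 - x ^ 2) =
      (b - x * a) * mehlerSeries a b 1 0 x + x * mehlerSeries a b 0 0 x := by linarith
  rw [h3] at h4
  rw [eq_div_of_mul_eq h.ne' h4]
  field_simp

theorem hasDerivAt_mehlerSeries_zero_zero (a b : ℝ) {x : ℝ} (hx : |x| < 1 / 128) :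
    HasDerivAt (mehlerSeries a b 0 0) (mehlerSeries a b 1 1 x) x := by
  obtain ⟨E, hE⟩ := exists_abs_mehlerCoeff_le a b 0 0
  refine (hasDerivAt_tsum_mul_pow (by norm_num) hE (hx.trans_eq (by norm_num))).congr_deriv ?_
  refine tsum_congr fun k => ?_
  rw [mehlerCoeff, mehlerCoeff, Nat.factorial_succ]
  push_cast
  field_simp

theorem mehlerSeries_zero_right (a b : ℝ) : mehlerSeries a b 0 0 0 = 1 := by
  rw [mehlerSeries, tsum_eq_single 0]
  · simp [mehlerCoeff, hermiteP_zero]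
  · intro k hk
    simp [hk]

/-- Mehler's formula, for small parameter. -/
theorem mehlerSeries_zero_zero (a b : ℝ) {x : ℝ} (hx : |x| < 1 / 128) :
    mehlerSeries a b 0 0 x * √(1 - x ^ 2) *
      Real.exp ((a - x * b) ^ 2 / (2 * (1 - x ^ 2)) - a ^ 2 / 2) = 1 := by
  have hderiv : ∀ y ∈ Set.Ioo (-(1 / 128 : ℝ)) (1 / 128), HasDerivAt
      (fun x => mehlerSeries a b 0 0 x * √(1 - x ^ 2) *
        Real.exp ((a - x * b) ^ 2 / (2 * (1 - x ^ 2)) - a ^ 2 / 2)) 0 y := by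
    intro y hy
    have hy' : |y| < 1 / 128 := abs_lt.2 hy
    have h := one_sub_sq_pos hy'
    have hd1 : HasDerivAt (fun x : ℝ => 1 - x ^ 2) (-(2 * y)) y := by
      simpa using (hasDerivAt_pow 2 y).const_sub 1
    have hd2 : HasDerivAt (fun x : ℝ => (a - x * b) ^ 2) (2 * (a - y * b) * (-b)) y := by
      simpa using (((hasDerivAt_id y).mul_const b).const_sub a).fun_pow 2
    have hd3 := (hd2.fun_div (hd1.const_mul 2) (by positivity)).sub_const (a ^ 2 / 2)
    have hd4 := (((hasDerivAt_mehlerSeries_zero_zero a b hy').mul (hd1.sqrt h.ne')).mul hd3.exp)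
    refine hd4.congr_deriv ?_
    rw [mehlerSeries_one_one a b hy']
    obtain ⟨s, hs, hs2⟩ : ∃ s, 0 < s ∧ 1 - y ^ 2 = s ^ 2 :=
      ⟨√(1 - y ^ 2), Real.sqrt_pos.2 h, (Real.sq_sqrt h.le).symm⟩
    simp only [Pi.mul_apply]
    rw [hs2, Real.sqrt_sq hs.le]
    field_simp
    grind
  have hconst := isOpen_Ioo.is_const_of_deriv_eq_zero isPreconnected_Ioo
    (fun y hy => (hderiv y hy).differentiableAt.differentiableWithinAt)
    (fun y hy => (hderiv y hy).deriv) (abs_lt.1 hx)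
    (show (0 : ℝ) ∈ Set.Ioo (-(1 / 128 : ℝ)) (1 / 128) by norm_num)
  rw [hconst]
  simp [mehlerSeries_zero_right]

theorem continuous_stdGaussianPDF : Continuous stdGaussianPDF := by
  unfold stdGaussianPDF
  fun_prop

theorem integrable_stdGaussianPDF : MeasureTheory.Integrable stdGaussianPDF := by
  unfold stdGaussianPDF
  refine MeasureTheory.Integrable.const_mul ?_ _
  convert integrable_exp_neg_mul_sq (b := 1 / 2) (by norm_num) using 3
  ring

theorem hasDerivAt_stdGaussianCDF (x : ℝ) :
    HasDerivAt stdGaussianCDF (stdGaussianPDF x) x := by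
  have h : stdGaussianCDF = fun x => stdGaussianCDF 0 + ∫ y in (0 : ℝ)..x, stdGaussianPDF y := by
    ext x
    rw [← intervalIntegral.integral_Iic_sub_Iic integrable_stdGaussianPDF.integrableOn
      integrable_stdGaussianPDF.integrableOn, stdGaussianCDF, stdGaussianCDF]
    ring
  rw [h]
  exact (continuous_stdGaussianPDF.integral_hasStrictDerivAt 0 x).hasDerivAt.const_add _

theorem stdGaussianPDF_nonneg (x : ℝ) : 0 ≤ stdGaussianPDF x := by
  unfold stdGaussianPDF
  positivity

theorem stdGaussianPDF_mul_exp_le_one (x : ℝ) : stdGaussianPDF x * Real.exp (x ^ 2 / 4) ≤ 1 := by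
  have h1 : 1 / √(2 * π) ≤ 1 := by
    rw [div_le_one (by positivity), Real.one_le_sqrt]
    linarith [Real.pi_gt_three]
  rw [stdGaussianPDF, mul_assoc, ← Real.exp_add]
  refine mul_le_one₀ h1 (Real.exp_nonneg _) (Real.exp_le_one_iff.2 ?_)
  nlinarith [sq_nonneg x]

/-- Coefficients of the expansion of `x ↦ Φ((a - x b) / √(1 - x²))`. -/
noncomputable def cdfCoeff (a b : ℝ) (k : ℕ) : ℝ :=
  hermiteP (k - 1) a * hermiteP k b / k.factorial

theorem abs_cdfCoeff_le (a b : ℝ) (k : ℕ) :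
    |cdfCoeff a b k| ≤ Real.exp (a ^ 2 / 4) * Real.exp (b ^ 2 / 4) * 16 ^ k := by
  rw [cdfCoeff, abs_div, abs_mul, Nat.abs_cast, div_le_iff₀ (by positivity)]
  have h1 : |hermiteP (k - 1) a| ≤ 4 ^ k * √(k.factorial) * Real.exp (a ^ 2 / 4) := by
    refine (abs_hermiteP_le _ _).trans ?_
    gcongr
    · norm_num
    · omega
    · omega
  calc _ ≤ (4 ^ k * √(k.factorial) * Real.exp (a ^ 2 / 4)) *
        (4 ^ k * √(k.factorial) * Real.exp (b ^ 2 / 4)) :=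
        mul_le_mul h1 (abs_hermiteP_le _ _) (abs_nonneg _) (by positivity)
    _ = Real.exp (a ^ 2 / 4) * Real.exp (b ^ 2 / 4) * (4 * 4) ^ k *
        (√(k.factorial) * √(k.factorial)) := by rw [mul_pow]; ring
    _ = _ := by rw [Real.mul_self_sqrt (by positivity)]; norm_num

theorem hasDerivAt_tsum_cdfCoeff (a b : ℝ) {x : ℝ} (hx : |x| < 1 / 128) :
    HasDerivAt (fun y => ∑' k, cdfCoeff a b k * y ^ k) (mehlerSeries a b 0 1 x) x := by
  refine (hasDerivAt_tsum_mul_pow (by norm_num) (abs_cdfCoeff_le a b)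
    (hx.trans (by norm_num))).congr_deriv (tsum_congr fun k => ?_)
  rw [mehlerCoeff, cdfCoeff, Nat.factorial_succ]
  push_cast
  field_simp
  simp only [add_zero]
  ring

theorem stdGaussianPDF_mul_mehlerSeries (a b : ℝ) {x : ℝ} (hx : |x| < 1 / 128) :
    stdGaussianPDF a * mehlerSeries a b 0 0 x * √(1 - x ^ 2) =
      stdGaussianPDF ((a - x * b) / √(1 - x ^ 2)) := by
  have h := mehlerSeries_zero_zero a b hx
  have hpos := one_sub_sq_pos hx
  rw [stdGaussianPDF, stdGaussianPDF, div_pow, Real.sq_sqrt hpos.le]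
  set e := (a - x * b) ^ 2 / (2 * (1 - x ^ 2)) with he
  have h1 : -((a - x * b) ^ 2 / (1 - x ^ 2)) / 2 = -e := by rw [he]; field_simp
  have h2 : -a ^ 2 / 2 = -(a ^ 2 / 2) := by ring
  rw [Real.exp_sub, ← mul_div_assoc, div_eq_one_iff_eq (Real.exp_ne_zero _)] at h
  rw [h1, h2, Real.exp_neg, Real.exp_neg, ← h]
  have hm : mehlerSeries a b 0 0 x * √(1 - x ^ 2) ≠ 0 := by
    intro h0
    rw [h0, zero_mul] at h
    exact Real.exp_ne_zero _ h.symm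
  have he0 := Real.exp_ne_zero e
  have hm1 := left_ne_zero_of_mul hm
  have hm2 := right_ne_zero_of_mul hm
  field_simp

theorem stdGaussianCDF_eq_sub_tsum (a b : ℝ) {x : ℝ} (hx : |x| < 1 / 128) :
    stdGaussianCDF ((a - x * b) / √(1 - x ^ 2)) =
      stdGaussianCDF a + stdGaussianPDF a - stdGaussianPDF a * ∑' k, cdfCoeff a b k * x ^ k := by
  have hderiv : ∀ y ∈ Set.Ioo (-(1 / 128 : ℝ)) (1 / 128), HasDerivAt
      (fun x => stdGaussianCDF ((a - x * b) / √(1 - x ^ 2)) +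
        stdGaussianPDF a * ∑' k, cdfCoeff a b k * x ^ k) 0 y := by
    intro y hy
    have hy' : |y| < 1 / 128 := abs_lt.2 hy
    have h := one_sub_sq_pos hy'
    have hs0 : √(1 - y ^ 2) ≠ 0 := (Real.sqrt_pos.2 h).ne'
    have hd1 : HasDerivAt (fun x : ℝ => 1 - x ^ 2) (-(2 * y)) y := by
      simpa using (hasDerivAt_pow 2 y).const_sub 1
    have hd2 : HasDerivAt (fun x : ℝ => a - x * b) (-b) y := by
      simpa using ((hasDerivAt_id y).mul_const b).const_sub a
    have hd3 := hd2.fun_div (hd1.sqrt h.ne') hs0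
    have hd4 := ((hasDerivAt_stdGaussianCDF _).comp y hd3).add
      ((hasDerivAt_tsum_cdfCoeff a b hy').const_mul (stdGaussianPDF a))
    refine hd4.congr_deriv ?_
    rw [← stdGaussianPDF_mul_mehlerSeries a b hy', mehlerSeries_zero_one a b hy']
    obtain ⟨s, hs, hs2⟩ : ∃ s, 0 < s ∧ 1 - y ^ 2 = s ^ 2 :=
      ⟨√(1 - y ^ 2), Real.sqrt_pos.2 h, (Real.sq_sqrt h.le).symm⟩
    rw [hs2, Real.sqrt_sq hs.le]
    field_simp
    grind
  have hconst := isOpen_Ioo.is_const_of_deriv_eq_zero isPreconnected_Ioo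
    (fun y hy => (hderiv y hy).differentiableAt.differentiableWithinAt)
    (fun y hy => (hderiv y hy).deriv) (abs_lt.1 hx)
    (show (0 : ℝ) ∈ Set.Ioo (-(1 / 128 : ℝ)) (1 / 128) by norm_num)
  have hzero : ∑' k, cdfCoeff a b k * (0 : ℝ) ^ k = 1 := by
    rw [tsum_eq_single 0]
    · simp [cdfCoeff, hermiteP_zero]
    · intro k hk
      simp [hk]
  simp only [hzero] at hconst
  norm_num at hconst
  linarith

theorem sum_range_odd_terms (c : ℕ → ℝ) (x : ℝ) (J : ℕ) :
    ∑ k ∈ Finset.range (2 * J + 3), c k * (x ^ k - (-x) ^ k) =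
      2 * ∑ k ∈ Finset.range (J + 1), c (2 * k + 1) * x ^ (2 * k + 1) := by
  induction J with
  | zero => simp [Finset.sum_range_succ]; ring
  | succ J ih =>
    rw [show 2 * (J + 1) + 3 = 2 * J + 3 + 1 + 1 by ring, Finset.sum_range_succ,
      Finset.sum_range_succ, ih, Finset.sum_range_succ _ (J + 1),
      show 2 * (J + 1) + 1 = 2 * J + 3 by ring,
      Odd.neg_pow ⟨J + 1, by ring⟩, Even.neg_pow ⟨J + 2, by ring⟩]
    ring

theorem abs_stdGaussianCDF_sub_sub_sum_le (a b : ℝ) (J : ℕ) {x : ℝ} (hx0 : 0 ≤ x)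
    (hx : x < 1 / 128) :
    |stdGaussianCDF ((a + x * b) / √(1 - x ^ 2)) - stdGaussianCDF ((a - x * b) / √(1 - x ^ 2)) -
      2 * stdGaussianPDF a *
        ∑ k ∈ Finset.range (J + 1), cdfCoeff a b (2 * k + 1) * x ^ (2 * k + 1)| ≤
      4 * Real.exp (b ^ 2 / 4) * (16 * x) ^ (2 * J + 3) := by
  have hxa : |x| < 1 / 128 := by rwa [abs_of_nonneg hx0]
  have hna : |(-x)| < 1 / 128 := by rwa [abs_neg]
  have hplus := stdGaussianCDF_eq_sub_tsum a b hxa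
  have hminus := stdGaussianCDF_eq_sub_tsum a b hna
  rw [neg_sq, neg_mul, sub_neg_eq_add] at hminus
  have hs1 := summable_of_abs_le_geometric (by norm_num) (abs_cdfCoeff_le a b)
    (hxa.trans (by norm_num))
  have hs2 := summable_of_abs_le_geometric (by norm_num) (abs_cdfCoeff_le a b)
    (hna.trans (by norm_num))
  have hs3 : Summable fun k => cdfCoeff a b k * (x ^ k - (-x) ^ k) := by
    simpa only [mul_sub] using hs1.sub hs2
  have hsplit := hs3.sum_add_tsum_nat_add (2 * J + 3)
  rw [sum_range_odd_terms] at hsplit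
  have hsub : ∑' k, cdfCoeff a b k * (x ^ k - (-x) ^ k) =
      ∑' k, cdfCoeff a b k * x ^ k - ∑' k, cdfCoeff a b k * (-x) ^ k := by
    simp only [mul_sub]
    exact hs1.tsum_sub hs2
  set E := Real.exp (a ^ 2 / 4) * Real.exp (b ^ 2 / 4) with hE
  have hg : HasSum (fun k : ℕ => 2 * E * (16 * x) ^ (2 * J + 3) * (1 / 2 : ℝ) ^ k)
      (2 * E * (16 * x) ^ (2 * J + 3) * 2) := hasSum_geometric_two.mul_left _
  have htail : ‖∑' k, cdfCoeff a b (k + (2 * J + 3)) *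
      (x ^ (k + (2 * J + 3)) - (-x) ^ (k + (2 * J + 3)))‖ ≤
      2 * E * (16 * x) ^ (2 * J + 3) * 2 := by
    refine tsum_of_norm_bounded hg fun k => ?_
    set N := k + (2 * J + 3) with hN
    have hpow : |x ^ N - (-x) ^ N| ≤ 2 * x ^ N := by
      refine (abs_sub _ _).trans ?_
      rw [abs_pow, abs_pow, abs_neg, abs_of_nonneg hx0]
      linarith
    rw [norm_mul, Real.norm_eq_abs, Real.norm_eq_abs]
    calc _ ≤ (E * 16 ^ N) * (2 * x ^ N) :=
          mul_le_mul (abs_cdfCoeff_le a b N) hpow (abs_nonneg _) (by positivity)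
      _ = 2 * E * (16 * x) ^ (2 * J + 3) * (16 * x) ^ k := by
          rw [hN, mul_pow, mul_pow, pow_add, pow_add]; ring
      _ ≤ _ := by
          gcongr
          linarith
  have hφ := stdGaussianPDF_nonneg a
  calc _ = |stdGaussianPDF a * ∑' k, cdfCoeff a b (k + (2 * J + 3)) *
      (x ^ (k + (2 * J + 3)) - (-x) ^ (k + (2 * J + 3)))| := by
        congr 1
        rw [hplus, hminus]
        linear_combination -stdGaussianPDF a * (hsplit.trans hsub)
    _ ≤ stdGaussianPDF a * (2 * E * (16 * x) ^ (2 * J + 3) * 2) := by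
        rw [abs_mul, abs_of_nonneg hφ]
        exact mul_le_mul_of_nonneg_left htail hφ
    _ = (stdGaussianPDF a * Real.exp (a ^ 2 / 4)) *
        (4 * Real.exp (b ^ 2 / 4) * (16 * x) ^ (2 * J + 3)) := by rw [hE]; ring
    _ ≤ _ := mul_le_of_le_one_left (by positivity) (stdGaussianPDF_mul_exp_le_one a)

theorem abs_cdfExpErr_le {κ : ℝ} (J : ℕ) {n : ℕ} (hn : 128 ^ 4 < rseq κ n) (y z : ℝ) :
    |cdfExpErr κ J n y z| ≤ 4 * 16 ^ (2 * J + 3) * Real.exp (y ^ 2 / (4 * √(rseq κ n))) *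
      (rseq κ n) ^ (-(2 * (J : ℝ) + 3) / 4) := by
  unfold cdfExpErr
  set r := rseq κ n with hrdef
  have hr0 : 0 < r := lt_trans (by norm_num) hn
  set q := r ^ ((1 : ℝ) / 4) with hq
  have hq0 : 0 < q := Real.rpow_pos_of_pos hr0 _
  have hrq : r = q ^ 4 := by
    rw [hq, ← Real.rpow_natCast, ← Real.rpow_mul hr0.le]
    norm_num
  have hsqrt : √r = q ^ 2 := by
    rw [hrq, show q ^ 4 = (q ^ 2) ^ 2 by ring, Real.sqrt_sq (by positivity)]
  have hq128 : 128 < q := by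
    rw [hrq] at hn
    exact lt_of_pow_lt_pow_left₀ 4 hq0.le hn
  have hpow : ∀ N : ℕ, r ^ (-(N : ℝ) / 4) = q⁻¹ ^ N := by
    intro N
    rw [show -(N : ℝ) / 4 = (1 / 4) * (-(N : ℝ)) by ring, Real.rpow_mul hr0.le, ← hq,
      Real.rpow_neg hq0.le, Real.rpow_natCast, inv_pow]
  have hx : q⁻¹ < 1 / 128 := by
    rw [one_div]
    exact inv_strictAnti₀ (by norm_num) hq128
  have hden : √(r - q ^ 2) = q ^ 2 * √(1 - q⁻¹ ^ 2) := by
    rw [show r - q ^ 2 = (q ^ 2) ^ 2 * (1 - q⁻¹ ^ 2) by rw [hrq]; field_simp,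
      Real.sqrt_mul (by positivity), Real.sqrt_sq (by positivity)]
  have hplus : (z + y) / √(r - q ^ 2) = (z / q ^ 2 + q⁻¹ * (y / q)) / √(1 - q⁻¹ ^ 2) := by
    rw [hden, ← div_div]
    congr 1
    field_simp
  have hminus : (z - y) / √(r - q ^ 2) = (z / q ^ 2 - q⁻¹ * (y / q)) / √(1 - q⁻¹ ^ 2) := by
    rw [hden, ← div_div]
    congr 1
    field_simp
  have key := abs_stdGaussianCDF_sub_sub_sum_le (z / q ^ 2) (y / q) J (inv_nonneg.2 hq0.le) hx
  have hsum : ∑ k ∈ Finset.range (J + 1), (1 / ((2 * k + 1).factorial : ℝ)) *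
      r ^ (-(2 * (k : ℝ) + 1) / 4) * hermiteP (2 * k) (z / q ^ 2) * hermiteP (2 * k + 1) (y / q) =
      ∑ k ∈ Finset.range (J + 1),
        cdfCoeff (z / q ^ 2) (y / q) (2 * k + 1) * q⁻¹ ^ (2 * k + 1) := by
    refine Finset.sum_congr rfl fun k _ => ?_
    have h := hpow (2 * k + 1)
    push_cast at h
    rw [h, cdfCoeff, Nat.add_sub_cancel]
    ring
  have hlast := hpow (2 * J + 3)
  push_cast at hlast
  rw [hsqrt, hplus, hminus, hsum, hlast]
  refine key.trans_eq ?_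
  rw [mul_pow, show (y / q) ^ 2 / 4 = y ^ 2 / (4 * q ^ 2) by field_simp]
  ring

theorem exp_sq_div_le_rseq_rpow {κ K y : ℝ} {n : ℕ} (hκ : 0 < κ) (hK : 0 ≤ K) (hn : 1 ≤ n)
    (hy : |y| ≤ √(K * √(rseq κ n) * Real.log n)) :
    Real.exp (y ^ 2 / (4 * √(rseq κ n))) ≤ (rseq κ n) ^ (K * κ / 4) := by
  have hn0 : (0 : ℝ) < n := by exact_mod_cast hn
  have hr0 : 0 < rseq κ n := Real.rpow_pos_of_pos hn0 _
  have hlog : 0 ≤ Real.log n := Real.log_natCast_nonneg n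
  have hy2 : y ^ 2 ≤ K * √(rseq κ n) * Real.log n := by
    rw [← sq_abs]
    exact (Real.le_sqrt (abs_nonneg y) (by positivity)).1 hy
  have hrlog : Real.log (rseq κ n) = 1 / κ * Real.log n := Real.log_rpow hn0 _
  have hs : 0 < √(rseq κ n) := Real.sqrt_pos.2 hr0
  rw [Real.rpow_def_of_pos hr0, hrlog, Real.exp_le_exp, div_le_iff₀ (by positivity)]
  refine hy2.trans_eq ?_
  field_simp

/-- Lemma 2.7: for `κ > 1`, `m ∈ ℕ`, `K > 0` and an integer `J > 2m + (Kκ − 1)/2`,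
the error in the truncated Hermite expansion of the Gaussian CDF difference satisfies
`r_n^{(2m+1)/2} · sup { |ε_n(y,z)| : z ∈ ℝ, |y| ≤ √(K √r_n log n) } → 0` as `n → ∞`. -/
theorem cdfExpErr_tendsto_zero (κ : ℝ) (hκ : 1 < κ) (m : ℕ) (K : ℝ) (hK : 0 < K)
    (J : ℕ) (hJ : 2 * (m : ℝ) + (K * κ - 1) / 2 < (J : ℝ)) :
    ∀ δ > 0, ∀ᶠ n : ℕ in atTop, ∀ z y : ℝ,
      |y| ≤ Real.sqrt (K * Real.sqrt (rseq κ n) * Real.log n) →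
      (rseq κ n) ^ ((2 * (m : ℝ) + 1) / 2) * |cdfExpErr κ J n y z| < δ := by
  intro δ hδ
  have hκ0 : 0 < κ := by linarith
  have hr : Tendsto (rseq κ) atTop atTop :=
    (tendsto_rpow_atTop (by positivity)).comp tendsto_natCast_atTop_atTop
  set s : ℝ := (2 * (J : ℝ) + 3 - K * κ) / 4 - (2 * (m : ℝ) + 1) / 2 with hs
  have hs0 : 0 < s := by rw [hs]; linarith
  have hlim : Tendsto (fun n => 4 * 16 ^ (2 * J + 3) * (rseq κ n) ^ (-s)) atTop (nhds 0) := by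
    simpa using ((tendsto_rpow_neg_atTop hs0).comp hr).const_mul (4 * 16 ^ (2 * J + 3))
  filter_upwards [hr.eventually_gt_atTop (128 ^ 4), hlim.eventually_lt_const hδ,
    eventually_ge_atTop 1] with n hn hlt hn1 z y hy
  have hr0 : 0 < rseq κ n := lt_trans (by norm_num) hn
  refine lt_of_le_of_lt ?_ hlt
  calc _ ≤ (rseq κ n) ^ ((2 * (m : ℝ) + 1) / 2) * (4 * 16 ^ (2 * J + 3) *
        ((rseq κ n) ^ (K * κ / 4) * (rseq κ n) ^ (-(2 * (J : ℝ) + 3) / 4))) := by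
        gcongr
        refine (abs_cdfExpErr_le J hn y z).trans ?_
        rw [mul_assoc (4 * 16 ^ (2 * J + 3) : ℝ)]
        gcongr
        exact exp_sq_div_le_rseq_rpow hκ0 hK.le hn1 hy
    _ = 4 * 16 ^ (2 * J + 3) * ((rseq κ n) ^ ((2 * (m : ℝ) + 1) / 2) *
        ((rseq κ n) ^ (K * κ / 4) * (rseq κ n) ^ (-(2 * (J : ℝ) + 3) / 4))) := by ring
    _ ≤ _ := by
        rw [← Real.rpow_add hr0, ← Real.rpow_add hr0]
        refine le_of_eq ?_
        congr 2
        rw [hs]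
        ring
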